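/- The zigzag graph Z admits no strictly positive, semifinite, indecomposable harmonic function. -/

import Mathlib

/-!
Common definitions: the zigzag graph on binary words, templates and their coideals,
zigzag flanges and sections, the functions `F_λ(u)` and `φ_{t,w}`, and harmonic /
semifinite / indecomposable functions on subgraphs of the zigzag graph.
-/

open scoped ENNReal NNReal

namespace Zigzag

/-- Binary words: `true` is `+`, `false` is `−`. -/
abbrev BW := List Bool

/-- `CoveredBy a b`: `b` covers `a` in the subword order, i.e. `|b| = |a| + 1` and `a`
is a subword of `b`; these are the edges of the zigzag graph. -/
def CoveredBy (a b : BW) : Prop := a.Sublist b ∧ b.length = a.length + 1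

/-- The set of upper neighbours of `a` lying in `S` is finite. -/
lemma upSet_finite (S : Set BW) (a : BW) : {b | b ∈ S ∧ CoveredBy a b}.Finite :=
  (List.finite_length_eq Bool (a.length + 1)).subset (fun _ hb => hb.2.2)

/-- The finset of upper neighbours of `a` inside `S`. -/
noncomputable def upFinset (S : Set BW) (a : BW) : Finset BW :=
  (upSet_finite S a).toFinset

/-- A `[0,∞]`-valued function is harmonic on `S ⊆ Z` (with the edges induced from the
zigzag graph) if its value at any vertex of `S` equals the sum of its values at the
upper neighbours lying in `S`. -/
def HarmonicOn (S : Set BW) (φ : BW → ℝ≥0∞) : Prop :=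
  ∀ a ∈ S, φ a = ∑ b ∈ upFinset S a, φ b

/-- A template: a nonempty sequence of clusters with alternating signs, each cluster
being a sign (`true` = `+`, `false` = `−`) with a multiplicity in `{1,2,…} ∪ {∞}`,
containing at least one infinite cluster. -/
structure Template where
  clusters : List (Bool × ℕ∞)
  ne : clusters ≠ []
  pos : ∀ c ∈ clusters, c.2 ≠ 0
  alternating : clusters.Chain' fun c d => c.1 ≠ d.1
  hasInf : ∃ c ∈ clusters, c.2 = ⊤

/-- The binary word obtained from a list of clusters by replacing every infinite
multiplicity by `N` (and keeping the finite multiplicities). -/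
def clWord (cs : List (Bool × ℕ∞)) (N : ℕ) : BW :=
  (cs.map fun c => List.replicate (if c.2 = ⊤ then N else c.2.toNat) c.1).flatten

/-- The coideal generated by a list of clusters: all binary words that are subwords of
some instantiation. -/
def Zcl (cs : List (Bool × ℕ∞)) : Set BW := {a | ∃ N, a.Sublist (clWord cs N)}

/-- The coideal `Z(t)` of the zigzag graph attached to a template `t`. -/
def Zt (t : Template) : Set BW := Zcl t.clusters

/-- The cluster in position `i` of `t` is a separating cluster: a one-symbol finite
cluster which is not outermost and whose two neighbours are infinite clusters
(necessarily of the same sign). -/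
def Template.isSep (t : Template) (i : ℕ) : Prop :=
  0 < i ∧ i + 1 < t.clusters.length ∧
  (t.clusters.getD i (true, 1)).2 = 1 ∧
  (t.clusters.getD (i - 1) (true, 1)).2 = ⊤ ∧
  (t.clusters.getD (i + 1) (true, 1)).2 = ⊤

/-- A template is finite if all its finite clusters are separating; otherwise it is
semifinite. -/
def Template.IsFiniteTemplate (t : Template) : Prop :=
  ∀ i < t.clusters.length, (t.clusters.getD i (true, 1)).2 ≠ ⊤ → t.isSep i

/-- The number of infinite clusters of a template. -/
def Template.numInf (t : Template) : ℕ :=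
  (t.clusters.filter fun c => decide (c.2 = ⊤)).length

/-- Position `p` of `t` carries a finite non-separating cluster, i.e. a cluster
contributing to the zigzag flange of `t`. -/
def IsFlangePos (t : Template) (p : ℕ) : Prop :=
  p < t.clusters.length ∧ (t.clusters.getD p (true, 1)).2 ≠ ⊤ ∧ ¬t.isSep p

/-- Decrease by one the multiplicity of the cluster in position `p`. -/
def decAt (cs : List (Bool × ℕ∞)) (p : ℕ) : List (Bool × ℕ∞) :=
  cs.set p ((cs.getD p (true, 1)).1, (cs.getD p (true, 1)).2 - 1)

/-- The coideal `J(t)`: the union of the coideals `Z(r)` over all `r` obtained from `t`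
by removing a single symbol from a cluster corresponding to a block of a binary word
from the zigzag flange of `t` (no merging of clusters is needed to generate `Z(r)`). -/
def Jt (t : Template) : Set BW :=
  {a | ∃ p, IsFlangePos t p ∧ a ∈ Zcl (decAt t.clusters p)}

/-- The canonical splitting of a template `t` into its zigzag flange
`fl(t) = (a₀, …, a_k)` (given by the lists `A 0, …, A k` of clusters, each consisting
of finite non-separating clusters of `t`) and its sections `t₁, …, t_k` (the maximal
groups of consecutive clusters forming finite templates), so that
`t = (a₀, t₁, a₁, …, a_{k−1}, t_k, a_k)`.  The two `interior` conditions express the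
maximality of the decomposition. -/
structure SectionData (t : Template) where
  k : ℕ
  A : Fin (k + 1) → List (Bool × ℕ∞)
  T : Fin k → Template
  concat : t.clusters
      = A 0 ++ (List.ofFn fun i : Fin k => (T i).clusters ++ A i.succ).flatten
  finA : ∀ j, ∀ c ∈ A j, c.2 ≠ ⊤
  secFin : ∀ i, (T i).IsFiniteTemplate
  interior_ne : ∀ j : Fin (k + 1), (j : ℕ) ≠ 0 → (j : ℕ) ≠ k → A j ≠ []
  interior_not_sep : ∀ j : Fin (k + 1), (j : ℕ) ≠ 0 → (j : ℕ) ≠ k →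
      ∀ s : Bool, A j ≠ [(s, 1)]

/-- The binary word corresponding to a list of finite clusters (a flange word). -/
def flangeWord (cs : List (Bool × ℕ∞)) : BW :=
  (cs.map fun c => List.replicate c.2.toNat c.1).flatten

/-- `a₀ ⊔ ℓ 1 ⊔ a₁ ⊔ … ⊔ ℓ k ⊔ a_k` (empty flange words disappear). -/
def assemble {t : Template} (D : SectionData t) (ℓ : Fin D.k → BW) : BW :=
  flangeWord (D.A 0) ++ (List.ofFn fun i : Fin D.k => ℓ i ++ flangeWord (D.A i.succ)).flatten

/-- `ℓ` is a decomposition of `a` along the sections of `t`: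
`bw(a) = a₀ ⊔ bw(ℓ 1) ⊔ a₁ ⊔ … ⊔ bw(ℓ k) ⊔ a_k` with `ℓ i ∈ Z(tᵢ)`. -/
def decompOf {t : Template} (D : SectionData t) (a : BW) (ℓ : Fin D.k → BW) : Prop :=
  (∀ i, ℓ i ∈ Zt (D.T i)) ∧ a = assemble D ℓ

/-- The signs of the infinite clusters of a list of clusters, in order. -/
def infSigns (cs : List (Bool × ℕ∞)) : List Bool :=
  (cs.filter fun c => decide (c.2 = ⊤)).map Prod.fst

/-- The number of weights consumed by the sections preceding the `i`-th one. -/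
def secOffset {t : Template} (D : SectionData t) (i : Fin D.k) : ℕ :=
  ∑ i' ∈ Finset.univ.filter (· < i), (infSigns (D.T i').clusters).length

/-- The part `vᵢ` of the tuple of weights `w` corresponding to the infinite clusters of
the `i`-th section, as a sequence of (sign, weight) pairs. -/
def vD {t : Template} (D : SectionData t) (w : List ℝ) (i : Fin D.k) : List (Bool × ℝ) :=
  (infSigns (D.T i).clusters).zip (w.drop (secOffset D i))

/-- `F_λ(u)` for a finite sequence `u` of (sign, length) pairs and a zigzag `λ`
(encoded by its binary word `a`, so that `λ` has `a.length + 1` boxes): the sum, over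
all decompositions of `λ` into `u.length` consecutive (possibly empty) zigzags
`λ(1), …, λ(m)` with `λ(i)` a row when the `i`-th sign is `+` and a column when it is
`−`, of `u₁ ^ |λ(1)| ⋯ u_m ^ |λ(m)|`.  A decomposition is recorded by the tuple `c` of
the numbers of boxes of the pieces; the row/column constraint says that the letters of
`a` strictly inside the `i`-th group of boxes all equal the `i`-th sign. -/
noncomputable def Fword (u : List (Bool × ℝ)) (a : BW) : ℝ :=
  ∑ c ∈ (Finset.Nat.antidiagonalTuple u.length (a.length + 1)).filter
      (fun c => ∀ i : Fin u.length,
        (a.drop (∑ i' ∈ Finset.univ.filter (· < i), c i')).take (c i - 1)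
          = List.replicate (c i - 1) (u.get i).1),
    ∏ i, (u.get i).2 ^ c i

open Classical in
/-- The function `φ_{t,w}` attached to a semifinite zigzag growth model `(t, w)`:
it equals `+∞` on `J(t)`, and on `Z(t) ∖ J(t)` it equals
`F_{λ^{(1)}}(v₁) ⋯ F_{λ^{(k)}}(v_k)`, where `(λ^{(1)}, …, λ^{(k)})` is the (unique)
decomposition of `λ` along the sections of `t` (it is `0` off `Z(t)`). -/
noncomputable def phiTW (t : Template) (D : SectionData t) (w : List ℝ) (a : BW) : ℝ≥0∞ :=
  if a ∉ Zt t then 0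
  else if a ∈ Jt t then ⊤
  else if h : ∃ ℓ : Fin D.k → BW, decompOf D a ℓ then
    ENNReal.ofReal (∏ i, Fword (vD D w i) (h.choose i))
  else 0

section Kcone

/-- The relation `λ = ∑_{μ : λ ↗ μ} μ` (within `S`) as an element of the free module. -/
noncomputable def relOf (S : Set BW) (a : BW) : BW →₀ ℝ :=
  Finsupp.single a 1 - ∑ b ∈ upFinset S a, Finsupp.single b 1

/-- The submodule of relations defining `K(S)`. -/
noncomputable def Krel (S : Set BW) : Submodule ℝ (BW →₀ ℝ) :=
  Submodule.span ℝ {f | ∃ a ∈ S, f = relOf S a}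

/-- The class of `f` in `K(S) = (⊕_{λ ∈ S} ℝ λ) ⧸ (relations)`. -/
noncomputable def kmk (S : Set BW) (f : BW →₀ ℝ) : (BW →₀ ℝ) ⧸ Krel S :=
  Submodule.Quotient.mk f

/-- Nonnegative formal combinations of vertices of `S`. -/
def NonnegOn (S : Set BW) (f : BW →₀ ℝ) : Prop :=
  (∀ x, 0 ≤ f x) ∧ ∀ x ∈ f.support, x ∈ S

/-- The cone `K⁺(S)` spanned by the vertices of `S` in `K(S)`. -/
noncomputable def Kpos (S : Set BW) : Set ((BW →₀ ℝ) ⧸ Krel S) :=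
  kmk S '' {f | NonnegOn S f}

/-- The order defined by the cone `K⁺(S)`: `x ≤_K y` iff `y − x ∈ K⁺(S)`. -/
def leK (S : Set BW) (x y : (BW →₀ ℝ) ⧸ Krel S) : Prop := y - x ∈ Kpos S

/-- The value of (the canonical extension of) `φ` at a nonnegative combination of
vertices. -/
noncomputable def phiHat (φ : BW → ℝ≥0∞) (f : BW →₀ ℝ) : ℝ≥0∞ :=
  ∑ x ∈ f.support, ENNReal.ofReal (f x) * φ x

/-- `φ` is finite on `S`. -/
def FiniteOn (S : Set BW) (φ : BW → ℝ≥0∞) : Prop := ∀ a ∈ S, φ a ≠ ⊤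

/-- `φ` is a semifinite function on (the graph) `S`: it is not everywhere finite, and
its value at any element `a` of the cone `K⁺` is the supremum of its values at the
elements `b ≤_K a` of the cone where it is finite. -/
def SemifiniteOn (S : Set BW) (φ : BW → ℝ≥0∞) : Prop :=
  (∃ a ∈ S, φ a = ⊤) ∧
  ∀ f : BW →₀ ℝ, NonnegOn S f →
    phiHat φ f =
      ⨆ g ∈ {g : BW →₀ ℝ |
        NonnegOn S g ∧ leK S (kmk S g) (kmk S f) ∧ phiHat φ g ≠ ⊤}, phiHat φ g

/-- A semifinite harmonic function `φ` on `S` is indecomposable if any finite or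
semifinite harmonic function `φ′ ≤ φ` on `S` which does not vanish identically on the
finiteness ideal of `φ` is a constant multiple of `φ` on that ideal. -/
def IndecSemifiniteOn (S : Set BW) (φ : BW → ℝ≥0∞) : Prop :=
  ∀ φ' : BW → ℝ≥0∞, HarmonicOn S φ' →
    (FiniteOn S φ' ∨ SemifiniteOn S φ') →
    (∀ a ∈ S, φ' a ≤ φ a) →
    (∃ a ∈ S, φ a ≠ ⊤ ∧ φ' a ≠ 0) →
    ∃ c : ℝ≥0, ∀ a ∈ S, φ a ≠ ⊤ → φ' a = (c : ℝ≥0∞) * φ a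

end Kcone

end Zigzag

namespace Zigzag

/-! ### Shuffles of zigzags -/

/-- Shuffles of the remaining parts `p`, `q` of two zigzags, when the last box comes from the
first one: passing from the first zigzag to the second produces the letter `s`, and passing
back produces `!s`. The first letter of `q` is irrelevant. -/
def shuffle : Bool → BW → BW → Multiset BW
  | _, p, [] => {p}
  | s, [], _ :: q => {s :: q}
  | s, x :: p, y :: q =>
      (shuffle s p (y :: q)).map (x :: ·) + (shuffle (!s) q (x :: p)).map (s :: ·)
termination_by _ p q => p.length + q.length

/-- Insertions of an extra box, extremal in the direction `s`, after the first box. -/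
def insertAfter (s : Bool) : BW → Multiset BW
  | [] => {[s]}
  | c :: x => {s :: (!s) :: x} + (insertAfter s x).map (c :: ·)

/-- The product of two zigzags, as a multiset of zigzags. -/
def zprod (s : Bool) (a b : BW) : Multiset BW :=
  shuffle s a (s :: b) + shuffle (!s) b (s :: a)

/-- The covers of a binary word. -/
def covers : BW → Multiset BW
  | [] => {[true]} + {[false]}
  | c :: x => {(!c) :: c :: x} + (covers x).map (c :: ·)

lemma shuffle_nil_right (s : Bool) (p : BW) : shuffle s p [] = {p} := by
  cases p <;> simp [shuffle]

lemma shuffle_nil_cons (s y : Bool) (q : BW) : shuffle s [] (y :: q) = {s :: q} := by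
  simp [shuffle]

lemma shuffle_cons_cons (s x y : Bool) (p q : BW) : shuffle s (x :: p) (y :: q) =
    (shuffle s p (y :: q)).map (x :: ·) + (shuffle (!s) q (x :: p)).map (s :: ·) := by
  rw [shuffle]

lemma shuffle_cons_right_congr (s y z : Bool) (p q : BW) :
    shuffle s p (y :: q) = shuffle s p (z :: q) := by
  induction p with
  | nil => simp [shuffle_nil_cons]
  | cons x p ih => rw [shuffle_cons_cons, shuffle_cons_cons, ih]

lemma shuffle_ne_zero (s : Bool) (p q : BW) : shuffle s p q ≠ 0 := by
  induction p with
  | nil => cases q <;> simp [shuffle_nil_cons, shuffle_nil_right]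
  | cons x p ih =>
    cases q with
    | nil => simp [shuffle_nil_right]
    | cons y q =>
      rw [shuffle_cons_cons]
      simp [ih]

lemma bind_map_cons_insertAfter (s x : Bool) (M : Multiset BW) :
    (M.map (x :: ·)).bind (insertAfter s) =
      M.map (fun w => s :: (!s) :: w) + (M.bind (insertAfter s)).map (x :: ·) := by
  simp [Multiset.bind_map, insertAfter, Multiset.map_bind]

lemma insertAfter_cons_bind (s x : Bool) (p : BW) (f : BW → Multiset BW) :
    (insertAfter s (x :: p)).bind f =
      f (s :: (!s) :: p) + (insertAfter s p).bind fun r => f (x :: r) := by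
  simp [insertAfter, Multiset.bind_map]

/-- Insertion of a box extremal in the direction `!s` commutes with shuffling. -/
lemma shuffle_bind_insertAfter (s : Bool) (n : ℕ) : ∀ p q : BW, p.length + q.length = n →
    (shuffle s p q).bind (insertAfter (!s)) = (insertAfter (!s) p).bind (shuffle s · q) ∧
    (shuffle (!s) q p).bind (insertAfter (!s)) = (insertAfter (!s) p).bind (shuffle (!s) q) := by
  induction n using Nat.strong_induction_on with
  | _ n ih =>
  intro p q hn
  rcases p with _ | ⟨x, p⟩ <;> rcases q with _ | ⟨y, q⟩
  · simp [insertAfter, shuffle_nil_right, shuffle_nil_cons]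
  · have h := (ih q.length (by simp at hn; omega) [] q (by simp)).2
    simp only [shuffle_nil_right, insertAfter, Multiset.singleton_bind] at h
    simp [insertAfter, shuffle_nil_right, shuffle_nil_cons, shuffle_cons_cons, h, add_comm]
  · refine ⟨?_, ?_⟩
    · simp only [shuffle_nil_right, Multiset.singleton_bind]
      exact ((Multiset.bind_singleton _ id).trans (Multiset.map_id _)).symm
    · rw [shuffle_nil_cons, insertAfter_cons_bind]
      simp [shuffle_nil_cons, insertAfter]
  · simp only [List.length_cons] at hn
    have hA := (ih (p.length + (y :: q).length) (by simp; omega) p (y :: q) rfl).1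
    have hB := (ih ((x :: p).length + q.length) (by simp; omega) (x :: p) q rfl).2
    have hc := shuffle_cons_right_congr (!s) s x q p
    constructor
    · rw [insertAfter_cons_bind] at hB ⊢
      simp only [shuffle_cons_cons, Multiset.add_bind, bind_map_cons_insertAfter, hA, hB,
        Multiset.bind_add, Multiset.map_add, Multiset.map_map, Multiset.map_bind, Bool.not_not,
        Function.comp_def, hc]
      abel
    · rw [insertAfter_cons_bind] at hB ⊢
      simp only [shuffle_cons_cons, Multiset.add_bind, bind_map_cons_insertAfter, hA, hB,
        Multiset.bind_add, Multiset.map_add, Multiset.map_map, Multiset.map_bind, Bool.not_not,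
        Function.comp_def, hc]
      abel

lemma covers_eq (s : Bool) (a : BW) : covers a = {(!s) :: a} + insertAfter s a := by
  induction a with
  | nil =>
    cases s
    · simp [covers, insertAfter]
    · exact Multiset.pair_comm _ _
  | cons c x ih =>
    rw [covers, ih, insertAfter]
    cases s <;> cases c <;> simp [Multiset.cons_swap]

lemma zprod_nil_right (s : Bool) (a : BW) : zprod s a [] = covers a := by
  rw [covers_eq s, zprod, shuffle_nil_cons, add_comm]
  congr 1
  induction a with
  | nil => simp [shuffle_nil_cons, insertAfter]
  | cons x p ih => simp [shuffle_cons_cons, shuffle_nil_cons, insertAfter, ih, add_comm]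

lemma zprod_swap (s : Bool) (a b : BW) : zprod s a b = zprod (!s) b a := by
  rw [zprod, zprod, add_comm, Bool.not_not, shuffle_cons_right_congr s s (!s),
    shuffle_cons_right_congr (!s) s (!s)]

lemma zprod_bind_covers (s : Bool) (a b : BW) :
    (zprod s a b).bind covers = (covers a).bind (zprod s · b) := by
  have h1 := (shuffle_bind_insertAfter s _ a (s :: b) rfl).1
  have h2 := (shuffle_bind_insertAfter s _ (s :: a) b rfl).2
  rw [insertAfter_cons_bind] at h2
  have h3 : covers = fun a => {s :: a} + insertAfter (!s) a := by
    ext1 a; simpa using covers_eq (!s) a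
  have hc := shuffle_cons_right_congr (!s) (!s) s b (s :: a)
  simp only [Bool.not_not] at h2
  rw [h3]
  simp only [Multiset.bind_add, Multiset.add_bind, Multiset.singleton_bind, zprod, h1, h2,
    Multiset.bind_singleton, Multiset.map_add, shuffle_cons_cons, hc]
  abel

lemma coveredBy_nil_iff (b : BW) : CoveredBy [] b ↔ b ∈ covers [] := by
  rcases b with _ | ⟨_ | _, _ | ⟨_, _⟩⟩ <;> simp [CoveredBy, covers]

lemma coveredBy_cons_iff (c : Bool) (x b : BW) : CoveredBy (c :: x) b ↔
    b = (!c) :: c :: x ∨ ∃ b', CoveredBy x b' ∧ c :: b' = b := by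
  constructor
  · rintro ⟨h, hl⟩
    rcases b with _ | ⟨d, b⟩
    · simp at hl
    by_cases hd : d = c
    · subst hd
      exact Or.inr ⟨b, ⟨by simpa using h, by simpa using hl⟩, rfl⟩
    · left
      rcases List.sublist_cons_iff.1 h with h | ⟨r, hr, -⟩
      · have := h.eq_of_length (by simpa using hl.symm)
        subst this
        cases c <;> cases d <;> simp_all
      · simp_all
  · rintro (rfl | ⟨b', ⟨h, hl⟩, rfl⟩)
    · exact ⟨List.sublist_cons_self _ _, by simp⟩
    · exact ⟨h.cons_cons c, by simp [hl]⟩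

lemma mem_covers (a b : BW) : b ∈ covers a ↔ CoveredBy a b := by
  induction a generalizing b with
  | nil => exact (coveredBy_nil_iff b).symm
  | cons c x ih => simp [covers, coveredBy_cons_iff, ih]

lemma nodup_covers (a : BW) : (covers a).Nodup := by
  induction a with
  | nil => simp [covers]
  | cons c x ih =>
    rw [covers, Multiset.singleton_add, Multiset.nodup_cons]
    exact ⟨by simp, ih.map (List.cons_injective)⟩

lemma upFinset_univ_val (a : BW) : (upFinset Set.univ a).val = covers a := by
  rw [Multiset.Nodup.ext (Finset.nodup _) (nodup_covers a)]
  intro b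
  simp [upFinset, mem_covers]

/-! ### Harmonic functions -/

lemma harmonicOn_univ_iff (φ : BW → ℝ≥0∞) :
    HarmonicOn Set.univ φ ↔ ∀ a, φ a = ((covers a).map φ).sum := by
  simp only [HarmonicOn, Set.mem_univ, true_imp_iff, Finset.sum, upFinset_univ_val]

/-- The value of `φ` at the product of two zigzags. -/
noncomputable def prodValue (s : Bool) (φ : BW → ℝ≥0∞) (b a : BW) : ℝ≥0∞ := ((zprod s a b).map φ).sum

lemma sum_map_bind (M : Multiset BW) (f : BW → Multiset BW) (φ : BW → ℝ≥0∞) :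
    ((M.bind f).map φ).sum = (M.map fun a => ((f a).map φ).sum).sum := by
  rw [Multiset.map_bind, Multiset.sum_bind]

lemma harmonicOn_prodValue {φ : BW → ℝ≥0∞} (hφ : HarmonicOn Set.univ φ) (s : Bool) (b : BW) : HarmonicOn Set.univ (prodValue s φ b) := by
  rw [harmonicOn_univ_iff] at hφ ⊢
  intro a
  unfold prodValue
  rw [← sum_map_bind, ← zprod_bind_covers, sum_map_bind]
  simp only [← hφ]

lemma prodValue_nil {φ : BW → ℝ≥0∞} (hφ : HarmonicOn Set.univ φ) (s : Bool) (b : BW) : prodValue s φ b [] = φ b := by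
  rw [prodValue, zprod_swap, zprod_nil_right, ← (harmonicOn_univ_iff φ).1 hφ]

lemma HarmonicOn.cons_le {φ : BW → ℝ≥0∞} (hφ : HarmonicOn Set.univ φ) (c : Bool) (a : BW) : φ (c :: a) ≤ φ a := by
  rw [hφ a (Set.mem_univ a)]
  refine Finset.single_le_sum (f := φ) (fun _ _ => zero_le) ?_
  simp [upFinset, CoveredBy]

lemma HarmonicOn.le_nil {φ : BW → ℝ≥0∞} (hφ : HarmonicOn Set.univ φ) (a : BW) : φ a ≤ φ [] := by
  induction a with
  | nil => rfl
  | cons c a ih => exact (HarmonicOn.cons_le hφ c a).trans ih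

lemma prodValue_le_right {φ : BW → ℝ≥0∞} (hφ : HarmonicOn Set.univ φ) (s : Bool) (b a : BW) : prodValue s φ b a ≤ φ b :=
  (HarmonicOn.le_nil (harmonicOn_prodValue hφ s b) a).trans_eq (prodValue_nil hφ s b)

lemma prodValue_le_left {φ : BW → ℝ≥0∞} (hφ : HarmonicOn Set.univ φ) (s : Bool) (b a : BW) : prodValue s φ b a ≤ φ a := by
  rw [prodValue, zprod_swap]
  exact prodValue_le_right hφ (!s) a b


lemma prodValue_pos {φ : BW → ℝ≥0∞} (hpos : ∀ a, 0 < φ a) (s : Bool) (b a : BW) :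
    prodValue s φ b a ≠ 0 := by
  obtain ⟨w, hw⟩ := Multiset.exists_mem_of_ne_zero (shuffle_ne_zero s a (s :: b))
  have hle : φ w ≤ prodValue s φ b a :=
    Multiset.single_le_sum (fun _ _ => zero_le) _
      (Multiset.mem_map_of_mem φ (Multiset.mem_add.2 (Or.inl hw)))
  exact ((hpos w).trans_le hle).ne'

/-- The linear extension of a finite harmonic function vanishes on the relations of `K(Z)`. -/
lemma linearCombination_toReal_eq_zero {θ : BW → ℝ≥0∞} (hθ : HarmonicOn Set.univ θ)
    (hfin : ∀ a, θ a ≠ ⊤) {f : BW →₀ ℝ} (hf : f ∈ Krel Set.univ) :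
    Finsupp.linearCombination ℝ (fun a => (θ a).toReal) f = 0 := by
  rw [← LinearMap.mem_ker]
  refine (Submodule.span_le (p := LinearMap.ker _)).2 ?_ hf
  rintro _ ⟨a, -, rfl⟩
  simp only [SetLike.mem_coe, LinearMap.mem_ker, relOf, map_sub, map_sum,
    Finsupp.linearCombination_single, one_smul]
  rw [hθ a (Set.mem_univ a), ENNReal.toReal_sum fun b _ => hfin b, sub_self]

lemma phiHat_eq_ofReal {θ : BW → ℝ≥0∞} (hfin : ∀ a, θ a ≠ ⊤) {f : BW →₀ ℝ}
    (hf : ∀ x, 0 ≤ f x) :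
    phiHat θ f =
      ENNReal.ofReal (Finsupp.linearCombination ℝ (fun a => (θ a).toReal) f) := by
  simp only [Finsupp.linearCombination_apply, Finsupp.sum, smul_eq_mul]
  rw [ENNReal.ofReal_sum_of_nonneg fun x _ => mul_nonneg (hf x) ENNReal.toReal_nonneg]
  refine Finset.sum_congr rfl fun x _ => ?_
  rw [ENNReal.ofReal_mul (hf x), ENNReal.ofReal_toReal (hfin x)]

/-- A finite harmonic function is monotone for the order of `K(Z)`. -/
lemma phiHat_mono {θ : BW → ℝ≥0∞} (hθ : HarmonicOn Set.univ θ) (hfin : ∀ a, θ a ≠ ⊤)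
    {f g : BW →₀ ℝ} (hf : NonnegOn Set.univ f) (hg : NonnegOn Set.univ g)
    (hgf : leK Set.univ (kmk Set.univ g) (kmk Set.univ f)) : phiHat θ g ≤ phiHat θ f := by
  obtain ⟨k, hk, hkeq⟩ := hgf
  have hmem : k - (f - g) ∈ Krel Set.univ := (Submodule.Quotient.eq _).1 hkeq
  have h0 := linearCombination_toReal_eq_zero hθ hfin hmem
  rw [phiHat_eq_ofReal hfin hf.1, phiHat_eq_ofReal hfin hg.1]
  apply ENNReal.ofReal_le_ofReal
  have hk0 : 0 ≤ Finsupp.linearCombination ℝ (fun a => (θ a).toReal) k := by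
    rw [Finsupp.linearCombination_apply]
    exact Finset.sum_nonneg fun x _ => mul_nonneg (hk.1 x) ENNReal.toReal_nonneg
  rw [map_sub, map_sub] at h0
  linarith

lemma nonnegOn_single (a : BW) : NonnegOn Set.univ (Finsupp.single a (1 : ℝ)) :=
  ⟨fun x => by rw [Finsupp.single_apply]; split_ifs <;> norm_num, fun _ _ => Set.mem_univ _⟩

lemma phiHat_single (φ : BW → ℝ≥0∞) (a : BW) : phiHat φ (Finsupp.single a 1) = φ a := by
  simp [phiHat]

lemma ne_top_of_phiHat_ne_top {φ : BW → ℝ≥0∞} {g : BW →₀ ℝ} (hg : NonnegOn Set.univ g)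
    (hfin : phiHat φ g ≠ ⊤) {x : BW} (hx : x ∈ g.support) : φ x ≠ ⊤ := by
  intro htop
  refine ENNReal.sum_ne_top.1 hfin x hx ?_
  have : 0 < g x := lt_of_le_of_ne (hg.1 x) (Finsupp.mem_support_iff.1 hx).symm
  rw [htop, ENNReal.mul_top (by simpa using this)]

/-- A nonzero semifinite function has a vertex where its value is finite. -/
lemma SemifiniteOn.exists_ne_top {φ : BW → ℝ≥0∞} (hφ : SemifiniteOn Set.univ φ) :
    ∃ a, φ a ≠ ⊤ := by
  by_contra! hall
  obtain ⟨a, -, ha⟩ := hφ.1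
  have h := hφ.2 _ (nonnegOn_single a)
  rw [phiHat_single, ha] at h
  refine ENNReal.top_ne_zero (h.trans (le_antisymm (iSup₂_le fun g hg => ?_) zero_le))
  refine (Finset.sum_eq_zero fun x hx => ?_).le
  exact absurd (hall x) (ne_top_of_phiHat_ne_top hg.1 hg.2.2 hx)

/-- A semifinite function is not proportional to a finite harmonic function on its
finiteness ideal. -/
lemma SemifiniteOn.not_proportional {φ θ : BW → ℝ≥0∞} (hφ : SemifiniteOn Set.univ φ)
    (hθ : HarmonicOn Set.univ θ) (hfin : ∀ a, θ a ≠ ⊤) {c : ℝ≥0} (hc : c ≠ 0) :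
    ¬ ∀ a, φ a ≠ ⊤ → θ a = (c : ℝ≥0∞) * φ a := by
  intro h
  obtain ⟨a, -, ha⟩ := hφ.1
  have hsup := hφ.2 _ (nonnegOn_single a)
  rw [phiHat_single, ha] at hsup
  have hc' : (c : ℝ≥0∞) ≠ 0 := by exact_mod_cast hc
  refine (ENNReal.div_lt_top (hfin a) hc').not_ge (hsup.trans_le (iSup₂_le fun g hg => ?_))
  rw [ENNReal.le_div_iff_mul_le (Or.inl hc') (Or.inl ENNReal.coe_ne_top), mul_comm,
    ← phiHat_single θ a]
  refine le_trans (le_of_eq ?_) (phiHat_mono hθ hfin (nonnegOn_single a) hg.1 hg.2.1)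
  rw [phiHat, phiHat, Finset.mul_sum]
  refine Finset.sum_congr rfl fun x hx => ?_
  rw [h x (ne_top_of_phiHat_ne_top hg.1 hg.2.2 hx), mul_left_comm]

/-- The full zigzag graph `Z` admits no strictly positive,
semifinite, indecomposable harmonic function. -/
theorem no_strictly_positive_semifinite_on_Z :
    ¬ ∃ φ : BW → ℝ≥0∞, HarmonicOn Set.univ φ ∧ (∀ a, 0 < φ a) ∧
      SemifiniteOn Set.univ φ ∧ IndecSemifiniteOn Set.univ φ := by
  rintro ⟨φ, hφ, hpos, hsemi, hindec⟩
  obtain ⟨b, hb⟩ := hsemi.exists_ne_top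
  have hfin : ∀ a, prodValue true φ b a ≠ ⊤ := fun a =>
    ne_top_of_le_ne_top hb (prodValue_le_right hφ true b a)
  have hne := prodValue_pos hpos true b
  have hharm := harmonicOn_prodValue hφ true b
  obtain ⟨c, hc⟩ := hindec _ hharm (Or.inl fun a _ => hfin a)
    (fun a _ => prodValue_le_left hφ true b a) ⟨b, Set.mem_univ b, hb, hne b⟩
  refine hsemi.not_proportional hharm hfin (c := c) ?_ fun a => hc a (Set.mem_univ a)
  rintro rfl
  exact hne b (by simpa using hc b (Set.mem_univ b) hb)

end Zigzag
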